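/- If T is a tree (a connected acyclic finite simple graph) of order n, then 2·ι_g(T) ≤ n, with equality if and only if T is isomorphic to the complete graph K_2. -/

import Mathlib

open SimpleGraph

variable {V : Type*}

/-- The closed neighborhood `N_G[X]` of a set `X` of vertices: all vertices that are in `X`
or adjacent to a vertex of `X`. -/
def closedNbhdSet (G : SimpleGraph V) (X : Set V) : Set V :=
  {u | u ∈ X ∨ ∃ x ∈ X, G.Adj x u}

/-- A vertex `v` is playable with respect to the set `X` of already selected vertices if the
closed neighborhood of `v` contains a vertex `u ∉ N_G[X]` having a neighbor `w ∉ N_G[X]`,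
i.e. `v` dominates a vertex of a nontrivial component of `G - N_G[X]`. -/
def IsPlayable (G : SimpleGraph V) (X : Set V) (v : V) : Prop :=
  ∃ u, (u = v ∨ G.Adj v u) ∧ u ∉ closedNbhdSet G X ∧
    ∃ w, G.Adj u w ∧ w ∉ closedNbhdSet G X

open Classical in
/-- The optimal-play value (number of further selected vertices) of the isolation game
position with given fuel, player to move (`true` = Dominator, the minimizer;
`false` = Staller, the maximizer) and set `X` of already selected vertices. -/
noncomputable def isoGameVal (G : SimpleGraph V) : ℕ → Bool → Set V → ℕ
  | 0, _, _ => 0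
  | (k + 1), isDom, X =>
    if ∃ v, IsPlayable G X v then
      (if isDom then sInf else sSup)
        {n : ℕ | ∃ v, IsPlayable G X v ∧ n = isoGameVal G k (!isDom) (insert v X) + 1}
    else 0

/-- The game isolation number `ι_g(G)`: the number of vertices selected in the isolation
game on `G` when Dominator moves first and both players play optimally.  (A game on a
graph with `n` vertices lasts at most `n` moves, so fuel `Fintype.card V` suffices.) -/
noncomputable def iotaGame (G : SimpleGraph V) [Fintype V] : ℕ :=
  isoGameVal G (Fintype.card V) true ∅

/-- The Staller-start game isolation number `ι_g'(G)`: the number of vertices selected in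
the isolation game on `G` when Staller moves first and both players play optimally. -/
noncomputable def iotaGame' (G : SimpleGraph V) [Fintype V] : ℕ :=
  isoGameVal G (Fintype.card V) false ∅

/-- The vertices of the nontrivial components of `G - N_G[X]`. -/
def liveSet (G : SimpleGraph V) (X : Set V) : Set V :=
  {u | u ∉ closedNbhdSet G X ∧ ∃ w, G.Adj u w ∧ w ∉ closedNbhdSet G X}

theorem mem_closedNbhdSet_insert {G : SimpleGraph V} {X : Set V} {u v : V} :
    u ∈ closedNbhdSet G (insert v X) ↔ (u = v ∨ G.Adj v u) ∨ u ∈ closedNbhdSet G X := by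
  simp only [closedNbhdSet, Set.mem_ofPred_eq, Set.mem_insert_iff, exists_eq_or_imp]
  tauto

theorem liveSet_insert_subset (G : SimpleGraph V) (X : Set V) (v : V) :
    liveSet G (insert v X) ⊆ liveSet G X := by
  rintro u ⟨hu, w, huw, hw⟩
  rw [mem_closedNbhdSet_insert] at hu hw
  exact ⟨fun h => hu (.inr h), w, huw, fun h => hw (.inr h)⟩

theorem notMem_liveSet_insert {G : SimpleGraph V} {X : Set V} {u v : V}
    (h : u = v ∨ G.Adj v u) : u ∉ liveSet G (insert v X) :=
  fun hu => hu.1 (mem_closedNbhdSet_insert.2 (.inl h))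

theorem ncard_liveSet_insert_add_card_le [Finite V] {G : SimpleGraph V} {X : Set V} {v : V}
    (s : Finset V) (hs : ∀ u ∈ s, u ∈ liveSet G X ∧ u ∉ liveSet G (insert v X)) :
    (liveSet G (insert v X)).ncard + s.card ≤ (liveSet G X).ncard := by
  have hd : Disjoint (liveSet G (insert v X)) (s : Set V) :=
    Set.disjoint_right.2 fun u hu => (hs u hu).2
  rw [← Set.ncard_coe_finset s, ← Set.ncard_union_eq hd]
  exact Set.ncard_le_ncard
    (Set.union_subset (liveSet_insert_subset G X v) fun u hu => (hs u hu).1)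

/-- Every nontrivial component of `G - N_G[X]` is a single edge. -/
def LiveEdgesDisjoint (G : SimpleGraph V) (X : Set V) : Prop :=
  ∀ u w w', u ∉ closedNbhdSet G X → w ∉ closedNbhdSet G X → w' ∉ closedNbhdSet G X →
    G.Adj u w → G.Adj u w' → w = w'

theorem LiveEdgesDisjoint.insert_vertex {G : SimpleGraph V} {X : Set V} (h : LiveEdgesDisjoint G X)
    (v : V) : LiveEdgesDisjoint G (insert v X) := by
  intro u w w' hu hw hw'
  rw [mem_closedNbhdSet_insert] at hu hw hw'
  exact h u w w' (fun h => hu (.inr h)) (fun h => hw (.inr h)) (fun h => hw' (.inr h))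

theorem LiveEdgesDisjoint.ncard_add_two_le [Finite V] {G : SimpleGraph V} {X : Set V} {v : V}
    (h : LiveEdgesDisjoint G X) (hv : IsPlayable G X v) :
    (liveSet G (insert v X)).ncard + 2 ≤ (liveSet G X).ncard := by
  classical
  obtain ⟨u, huv, hu, w, huw, hw⟩ := hv
  rw [← Finset.card_pair huw.ne]
  refine ncard_liveSet_insert_add_card_le {u, w} ?_
  simp only [Finset.mem_insert, Finset.mem_singleton, forall_eq_or_imp, forall_eq]
  refine ⟨⟨⟨hu, w, huw, hw⟩, notMem_liveSet_insert huv⟩, ⟨hw, u, huw.symm, hu⟩, ?_⟩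
  rintro ⟨-, x, hwx, hx⟩
  rw [mem_closedNbhdSet_insert] at hx
  obtain rfl := h w u x hw hu (fun h => hx (.inr h)) huw.symm hwx
  exact hx (.inl huv)

theorem isoGameVal_eq_zero {G : SimpleGraph V} {X : Set V} (h : ¬ ∃ v, IsPlayable G X v)
    (k : ℕ) (b : Bool) : isoGameVal G k b X = 0 := by
  cases k <;> simp [isoGameVal, h]

theorem isoGameVal_true_le {G : SimpleGraph V} {X : Set V} {v : V} (hv : IsPlayable G X v)
    (k : ℕ) : isoGameVal G (k + 1) true X ≤ isoGameVal G k false (insert v X) + 1 := by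
  rw [isoGameVal, if_pos ⟨v, hv⟩]
  exact Nat.sInf_le ⟨v, hv, rfl⟩

theorem isoGameVal_false_le {G : SimpleGraph V} {X : Set V}
    (h : ∃ v, IsPlayable G X v) {k B : ℕ}
    (hB : ∀ v, IsPlayable G X v → isoGameVal G k true (insert v X) + 1 ≤ B) :
    isoGameVal G (k + 1) false X ≤ B := by
  rw [isoGameVal, if_pos h]
  obtain ⟨v, hv⟩ := h
  refine csSup_le ⟨_, v, hv, rfl⟩ ?_
  rintro n ⟨w, hw, rfl⟩
  exact hB w hw

theorem isoGameVal_true_pos {G : SimpleGraph V} {X : Set V} {v : V} (hv : IsPlayable G X v)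
    (k : ℕ) : 0 < isoGameVal G (k + 1) true X := by
  rw [isoGameVal, if_pos ⟨v, hv⟩]
  have hne : {n : ℕ | ∃ v, IsPlayable G X v ∧
      n = isoGameVal G k (!true) (insert v X) + 1}.Nonempty := ⟨_, v, hv, rfl⟩
  obtain ⟨w, -, hw⟩ := Nat.sInf_mem hne
  simp only [if_true]
  omega

theorem isoGameVal_bounds [Finite V] (G : SimpleGraph V) (k : ℕ) : ∀ X : Set V,
    2 * isoGameVal G k true X ≤ (liveSet G X).ncard ∧
    2 * isoGameVal G k false X ≤ (liveSet G X).ncard + 1 ∧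
    (LiveEdgesDisjoint G X → 2 * isoGameVal G k false X ≤ (liveSet G X).ncard) := by
  classical
  induction k with
  | zero => simp [isoGameVal]
  | succ k ih =>
    intro X
    by_cases hp : ∃ v, IsPlayable G X v
    swap
    · simp [isoGameVal_eq_zero hp]
    refine ⟨?_, ?_, fun hm => ?_⟩
    · by_cases hm : LiveEdgesDisjoint G X
      · obtain ⟨v, hv⟩ := hp
        have := isoGameVal_true_le hv k
        have := (ih (insert v X)).2.2 (hm.insert_vertex v)
        have := hm.ncard_add_two_le hv
        omega
      · simp only [LiveEdgesDisjoint, not_forall] at hm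
        obtain ⟨u, w, w', hu, hw, hw', huw, huw', hne⟩ := hm
        have := isoGameVal_true_le (v := u) ⟨u, .inl rfl, hu, w, huw, hw⟩ k
        have := (ih (insert u X)).2.1
        have hc := ncard_liveSet_insert_add_card_le (G := G) (X := X) (v := u) {u, w, w'} (by
          simp only [Finset.mem_insert, Finset.mem_singleton, forall_eq_or_imp, forall_eq]
          exact ⟨⟨⟨hu, w, huw, hw⟩, notMem_liveSet_insert (.inl rfl)⟩,
            ⟨⟨hw, u, huw.symm, hu⟩, notMem_liveSet_insert (.inr huw)⟩,
            ⟨⟨hw', u, huw'.symm, hu⟩, notMem_liveSet_insert (.inr huw')⟩⟩)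
        rw [Finset.card_eq_three.2 ⟨u, w, w', huw.ne, huw'.ne, hne, rfl⟩] at hc
        omega
    · have : isoGameVal G (k + 1) false X ≤ ((liveSet G X).ncard + 1) / 2 := by
        refine isoGameVal_false_le hp fun v ⟨u, huv, hu⟩ => ?_
        have := (ih (insert v X)).1
        have hc := ncard_liveSet_insert_add_card_le (G := G) (X := X) (v := v) {u} (by
          simpa using ⟨hu, notMem_liveSet_insert huv⟩)
        rw [Finset.card_singleton] at hc
        omega
      omega
    · have : isoGameVal G (k + 1) false X ≤ (liveSet G X).ncard / 2 := by
        refine isoGameVal_false_le hp fun v hv => ?_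
        have := (ih (insert v X)).1
        have := hm.ncard_add_two_le hv
        omega
      omega

theorem two_mul_iotaGame_le [Fintype V] (G : SimpleGraph V) :
    2 * iotaGame G ≤ Fintype.card V := by
  have := (isoGameVal_bounds G (Fintype.card V) ∅).1
  have := Set.ncard_le_card (liveSet G ∅)
  rw [Nat.card_eq_fintype_card] at this
  unfold iotaGame
  omega

theorem mem_liveSet_empty {G : SimpleGraph V} {u w : V} (h : G.Adj u w) : u ∈ liveSet G ∅ := by
  simpa [liveSet, closedNbhdSet] using ⟨w, h⟩

theorem SimpleGraph.Connected.exists_adj_notMem [Fintype V] {G : SimpleGraph V}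
    (hG : G.Connected) {s : Finset V} (hs : s.Nonempty) (hcard : s.card < Fintype.card V) :
    ∃ a ∈ s, ∃ b ∉ s, G.Adj a b := by
  obtain ⟨u, hu⟩ := hs
  obtain ⟨v, hv⟩ : ∃ v, v ∉ s := by
    by_contra! h
    exact hcard.ne (Finset.card_eq_iff_eq_univ s |>.2 (Finset.eq_univ_of_forall h))
  obtain ⟨p⟩ := hG.preconnected u v
  obtain ⟨d, -, h₁, h₂⟩ := p.exists_boundary_dart (s : Set V) hu hv
  exact ⟨d.fst, h₁, d.snd, h₂, d.adj⟩

theorem two_mul_iotaGame_lt_of_card_four [Fintype V] {G : SimpleGraph V} {v : V}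
    (s : Finset V) (hs : s.card = 4) (hlive : ∀ u ∈ s, u ∈ liveSet G ∅)
    (hdead : ∀ u ∈ s, u ∉ liveSet G (insert v ∅)) (hv : IsPlayable G ∅ v) :
    2 * iotaGame G < Fintype.card V := by
  have hc := ncard_liveSet_insert_add_card_le s fun u hu => ⟨hlive u hu, hdead u hu⟩
  have hle := Set.ncard_le_card (liveSet G ∅)
  rw [Nat.card_eq_fintype_card] at hle
  obtain ⟨k, hk⟩ : ∃ k, Fintype.card V = k + 1 := ⟨Fintype.card V - 1, by omega⟩
  have := isoGameVal_true_le hv k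
  have := (isoGameVal_bounds G k (insert v ∅)).2.1
  rw [iotaGame, hk]
  omega

theorem two_mul_iotaGame_lt [Fintype V] {G : SimpleGraph V} (hG : G.IsTree)
    (h4 : 4 ≤ Fintype.card V) : 2 * iotaGame G < Fintype.card V := by
  classical
  have hnt : Nontrivial V := Fintype.one_lt_card_iff_nontrivial.1 (by omega)
  obtain ⟨a, ha⟩ := hG.exists_vert_degree_one_of_nontrivial
  obtain ⟨b, hab, hb⟩ := (degree_eq_one_iff_existsUnique_adj).1 ha
  obtain ⟨x, hx, c, hc, hxc⟩ := hG.connected.exists_adj_notMem (s := {a, b}) (by simp)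
    (by rw [Finset.card_pair hab.ne]; omega)
  simp only [Finset.mem_insert, Finset.mem_singleton, not_or] at hx hc
  obtain rfl | rfl := hx
  · exact absurd (hb c hxc) hc.2
  obtain ⟨y, hy, d, hd, hyd⟩ := hG.connected.exists_adj_notMem (s := {a, x, c}) (by simp)
    (by rw [Finset.card_eq_three.2 ⟨a, x, c, hab.ne, Ne.symm hc.1, hxc.ne, rfl⟩]; omega)
  simp only [Finset.mem_insert, Finset.mem_singleton, not_or] at hy hd
  have hcard : ({a, x, c, d} : Finset V).card = 4 := by
    have := hab.ne
    have := hxc.ne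
    grind
  have hplay : ∀ {u w}, G.Adj u w → IsPlayable G ∅ u := fun h =>
    ⟨_, .inl rfl, mem_liveSet_empty h⟩
  obtain rfl | rfl | rfl := hy
  · exact absurd (hb d hyd) hd.2.1
  · refine two_mul_iotaGame_lt_of_card_four _ hcard ?_ ?_ (hplay hyd) <;>
      simp only [Finset.mem_insert, Finset.mem_singleton, forall_eq_or_imp, forall_eq]
    · exact ⟨mem_liveSet_empty hab, mem_liveSet_empty hyd, mem_liveSet_empty hxc.symm,
        mem_liveSet_empty hyd.symm⟩
    · exact ⟨notMem_liveSet_insert (.inr hab.symm), notMem_liveSet_insert (.inl rfl),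
        notMem_liveSet_insert (.inr hxc), notMem_liveSet_insert (.inr hyd)⟩
  · refine two_mul_iotaGame_lt_of_card_four _ hcard ?_ ?_ (hplay hyd) <;>
      simp only [Finset.mem_insert, Finset.mem_singleton, forall_eq_or_imp, forall_eq]
    · exact ⟨mem_liveSet_empty hab, mem_liveSet_empty hxc, mem_liveSet_empty hyd,
        mem_liveSet_empty hyd.symm⟩
    · refine ⟨?_, notMem_liveSet_insert (.inr hxc.symm),
        notMem_liveSet_insert (.inl rfl), notMem_liveSet_insert (.inr hyd)⟩
      rintro ⟨-, w, haw, hw⟩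
      obtain rfl := hb w haw
      exact hw (mem_closedNbhdSet_insert.2 (.inl (.inr hxc.symm)))

theorem SimpleGraph.Connected.eq_top_of_card_eq_two [Fintype V] {G : SimpleGraph V}
    (hG : G.Connected) (h2 : Fintype.card V = 2) : G = ⊤ := by
  classical
  refine top_le_iff.1 fun a b hab => ?_
  obtain ⟨x, hx, c, hc, hxc⟩ := hG.exists_adj_notMem (s := {a}) (by simp) (by simp [h2])
  have hu : ({a, b} : Finset V) = Finset.univ := by
    rw [← Finset.card_eq_iff_eq_univ, Finset.card_pair hab.ne, h2]
  have hcu : c ∈ ({a, b} : Finset V) := hu ▸ Finset.mem_univ c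
  grind

/-- Corollary 4.1: if `T` is a tree of order `n`, then `ι_g(T) ≤ n/2`, with equality
if and only if `T = K_2`. -/
theorem tree_game_isolation_half_bound {V : Type*} [Fintype V] (G : SimpleGraph V)
    (hT : G.IsTree) :
    2 * iotaGame G ≤ Fintype.card V ∧
    (2 * iotaGame G = Fintype.card V ↔ Nonempty (G ≃g completeGraph (Fin 2))) := by
  refine ⟨two_mul_iotaGame_le G, fun h => ?_, fun ⟨e⟩ => ?_⟩
  · have hpos : 0 < Fintype.card V := Fintype.card_pos_iff.2 hT.connected.nonempty
    have h2 : Fintype.card V = 2 := by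
      by_cases h4 : 4 ≤ Fintype.card V
      · exact absurd h (two_mul_iotaGame_lt hT h4).ne
      · omega
    obtain rfl := hT.connected.eq_top_of_card_eq_two h2
    exact ⟨Iso.completeGraph (Fintype.equivFinOfCardEq h2)⟩
  · have h2 : Fintype.card V = 2 := by simpa using Fintype.card_congr e.toEquiv
    have hadj : G.Adj (e.symm 0) (e.symm 1) := e.symm.map_adj_iff.2 (by simp)
    have hle := two_mul_iotaGame_le G
    have hpos : 0 < iotaGame G := by
      rw [iotaGame, h2]
      exact isoGameVal_true_pos ⟨_, .inl rfl, mem_liveSet_empty hadj⟩ 1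
    omega
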